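/- arXiv:1705.07665 — 3 statements merged into one kernel-verified Lean document; each statement's English description precedes it below -/
import Mathlib

section
/- If A is an infinite-dimensional C*-algebra, then there exists a sequence (a_n) of non-zero positive elements of A such that a_j · a_k = 0 whenever j ≠ k. -/
section Helpers

variable {A : Type*} [NonUnitalCStarAlgebra A]

/-- Existence of a sequence of pairwise orthogonal non-zero positive elements. -/
def HasOrthSeq (A : Type*) [NonUnitalCStarAlgebra A] [PartialOrder A] : Prop :=
  ∃ a : ℕ → A, (∀ n, a n ≠ 0 ∧ 0 ≤ a n) ∧ ∀ j k, j ≠ k → a j * a k = 0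

/-- A self-adjoint element with infinite quasispectrum yields an orthogonal sequence. -/
lemma hasOrthSeq_of_infinite [PartialOrder A] [StarOrderedRing A] (a : A)
    (ha : IsSelfAdjoint a) (hs : (quasispectrum ℝ a).Infinite) : HasOrthSeq A := by
  have : Infinite (quasispectrum ℝ a) := hs.to_subtype
  obtain ⟨U, hUi, hUo, hUd⟩ :=
    exists_seq_infinite_isOpen_pairwise_disjoint (quasispectrum ℝ a)
  set C : ℕ → Set ℝ := fun n => Subtype.val '' (U n)ᶜ with hC
  have hf0 : ∀ n, (fun t : ℝ => |t| * Metric.infDist t (C n)) 0 = 0 := by intro n; simp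
  have hfc : ∀ n, Continuous (fun t : ℝ => |t| * Metric.infDist t (C n)) := by
    intro n
    exact continuous_abs.mul (Metric.continuous_infDist_pt _)
  refine ⟨fun n => cfcₙ (fun t : ℝ => |t| * Metric.infDist t (C n)) a, fun n => ⟨?_, ?_⟩, ?_⟩
  · intro h0
    rw [← cfcₙ_zero ℝ a] at h0
    have heq := eqOn_of_cfcₙ_eq_cfcₙ h0 ha (hfc n).continuousOn (hf0 n)
      continuousOn_const rfl
    obtain ⟨t, htU, ht0⟩ := ((hUi n).sdiff
      (Set.finite_singleton (⟨0, quasispectrum.zero_mem ℝ a⟩ : quasispectrum ℝ a))).nonempty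
    have h1 := heq t.2
    have ht0' : (t : ℝ) ≠ 0 := fun h => ht0 (Subtype.ext h)
    simp only [Pi.zero_apply, mul_eq_zero, abs_eq_zero, ht0', false_or] at h1
    have hne : (C n).Nonempty := by
      obtain ⟨u, hu⟩ := (hUi (n + 1)).nonempty
      refine ⟨u, u, ?_, rfl⟩
      have := hUd (show n + 1 ≠ n by omega)
      exact Set.disjoint_left.1 this hu
    have hcl : (t : ℝ) ∈ closure (C n) := (Metric.mem_closure_iff_infDist_zero hne).2 h1
    have : t ∈ closure ((U n)ᶜ) := closure_subtype.2 hcl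
    rw [(hUo n).isClosed_compl.closure_eq] at this
    exact this htU
  · exact cfcₙ_nonneg fun t _ => mul_nonneg (abs_nonneg _) Metric.infDist_nonneg
  · intro j k hjk
    simp only
    rw [← cfcₙ_mul _ _ a (hfc j).continuousOn (hf0 j) (hfc k).continuousOn (hf0 k),
      ← cfcₙ_zero ℝ a]
    refine cfcₙ_congr fun t ht => ?_
    have hmem : t ∈ C j ∨ t ∈ C k := by
      by_cases h : (⟨t, ht⟩ : quasispectrum ℝ a) ∈ U j
      · exact Or.inr ⟨⟨t, ht⟩, Set.disjoint_left.1 (hUd hjk) h, rfl⟩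
      · exact Or.inl ⟨⟨t, ht⟩, h, rfl⟩
    rcases hmem with h | h <;> simp [Metric.infDist_zero_of_mem h]

/-- Spectral projections. -/
lemma exists_proj (a : A) (ha : IsSelfAdjoint a) (h0 : a ≠ 0)
    (hs : (quasispectrum ℝ a).Finite) :
    ∃ (q y : A) (c : ℝ), IsStarProjection q ∧ q ≠ 0 ∧ q = a * y * a ∧ a * q = c • q := by
  have hex : ∃ c ∈ quasispectrum ℝ a, c ≠ 0 := by
    by_contra hcon
    push Not at hcon
    exact h0 (CFC.eq_zero_of_quasispectrum_eq_zero (R := ℝ) a (fun x hx => hcon x hx) ha)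
  obtain ⟨c, hc, hc0⟩ := hex
  have hcont : ∀ f : ℝ → ℝ, ContinuousOn f (quasispectrum ℝ a) := fun f => hs.continuousOn f
  set f : ℝ → ℝ := fun t => if t = c then 1 else 0 with hf
  have hf0 : f 0 = 0 := by simp [hf, hc0.symm]
  set g : ℝ → ℝ := fun t => if t = c then (c * c)⁻¹ else 0 with hg
  have hg0 : g 0 = 0 := by simp [hg, hc0.symm]
  have hid : cfcₙ (fun x : ℝ => x) a = a := cfcₙ_id' ℝ a ha
  refine ⟨cfcₙ f a, cfcₙ g a, c, ⟨?_, ?_⟩, ?_, ?_, ?_⟩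
  · change _ * _ = _
    rw [← cfcₙ_mul f f a (hcont _) hf0 (hcont _) hf0]
    congr 1
    ext t
    simp [hf]
  · exact cfcₙ_predicate f a
  · intro hz
    rw [← cfcₙ_zero ℝ a] at hz
    have := eqOn_of_cfcₙ_eq_cfcₙ hz ha (hcont _) hf0 (hcont _) rfl hc
    simp [hf] at this
  · have h1 : a * cfcₙ g a * a = cfcₙ (fun x : ℝ => x) a * cfcₙ g a * cfcₙ (fun x : ℝ => x) a := by
      rw [hid]
    rw [h1, ← cfcₙ_mul (fun x : ℝ => x) g a (hcont _) rfl (hcont _) hg0,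
      ← cfcₙ_mul _ (fun x : ℝ => x) a (hcont _) (by simp) (hcont _) rfl]
    congr 1
    ext t
    by_cases h : t = c
    · simp only [hf, hg, h, if_true]; field_simp
    · simp [hf, hg, h]
  · have h1 : a * cfcₙ f a = cfcₙ (fun x : ℝ => x) a * cfcₙ f a := by rw [hid]
    rw [h1, ← cfcₙ_mul (fun x : ℝ => x) f a (hcont _) rfl (hcont _) hf0,
      ← cfcₙ_const_mul c f a (hcont _) hf0]
    congr 1
    ext t
    by_cases h : t = c <;> simp [hf, h]

/-- Minimal projections. -/
def MinProj (p : A) : Prop :=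
  IsStarProjection p ∧ p ≠ 0 ∧ ∀ x : A, ∃ c : ℂ, p * x * p = c • p

lemma proj_nonneg [PartialOrder A] [StarOrderedRing A] {p : A} (hp : IsStarProjection p) :
    0 ≤ p := by
  have := star_mul_self_nonneg p
  rwa [hp.isSelfAdjoint.star_eq, hp.isIdempotentElem.eq] at this

/-- A non-minimal projection strictly dominates a non-zero projection. -/
lemma exists_smaller (hfin : ∀ a : A, IsSelfAdjoint a → (quasispectrum ℝ a).Finite)
    (p : A) (hp : IsStarProjection p) (hp0 : p ≠ 0) (hm : ¬ MinProj p) :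
    ∃ q : A, IsStarProjection q ∧ q ≠ 0 ∧ q ≠ p ∧ p * q = q ∧ q * p = q := by
  have hpp : p * p = p := hp.isIdempotentElem
  have hps : star p = p := hp.isSelfAdjoint
  by_contra hcon
  push Not at hcon
  have key : ∀ x : A, IsSelfAdjoint x → ∃ c : ℂ, p * x * p = c • p := by
    intro x hx
    by_cases hz : p * x * p = 0
    · exact ⟨0, by simp [hz]⟩
    have hsa : IsSelfAdjoint (p * x * p) := by
      rw [IsSelfAdjoint, star_mul, star_mul, hps, hx.star_eq, mul_assoc]
    obtain ⟨q, y, c, hq, hq0, hqe, hqc⟩ := exists_proj _ hsa hz (hfin _ hsa)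
    have h1 : p * q = q := by
      rw [hqe]; simp only [← mul_assoc, hpp]
    have h2 : q * p = q := by
      rw [hqe]; simp only [mul_assoc, hpp]
    by_cases hqp : q = p
    · refine ⟨(c : ℂ), ?_⟩
      rw [hqp, mul_assoc, hpp] at hqc
      rw [hqc]
      exact (Complex.coe_smul c p).symm
    · exact absurd h2 (hcon q hq hq0 hqp h1)
  refine hm ⟨hp, hp0, fun x => ?_⟩
  obtain ⟨c, hc⟩ := key (realPart x : A) (realPart x).2
  obtain ⟨d, hd⟩ := key (imaginaryPart x : A) (imaginaryPart x).2
  refine ⟨c + Complex.I * d, ?_⟩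
  conv_lhs => rw [← realPart_add_I_smul_imaginaryPart x]
  rw [mul_add, add_mul, hc, mul_smul_comm, smul_mul_assoc, hd, add_smul, mul_smul]

/-- Every non-zero projection dominates a minimal one. -/
lemma exists_min [PartialOrder A] [StarOrderedRing A] (hno : ¬ HasOrthSeq A)
    (hfin : ∀ a : A, IsSelfAdjoint a → (quasispectrum ℝ a).Finite)
    (p : A) (hp : IsStarProjection p) (hp0 : p ≠ 0) :
    ∃ r : A, MinProj r ∧ p * r = r ∧ r * p = r := by
  by_contra hcon
  push Not at hcon
  let T := {q : A // IsStarProjection q ∧ q ≠ 0 ∧ p * q = q ∧ q * p = q}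
  have step : ∀ q : T, ∃ q' : T, q'.1 ≠ q.1 ∧ q.1 * q'.1 = q'.1 ∧ q'.1 * q.1 = q'.1 := by
    rintro ⟨q, hq, hq0, h1, h2⟩
    obtain ⟨r, hr, hr0, hrq, h3, h4⟩ := exists_smaller hfin q hq hq0
      (fun hm => hcon q hm h1 h2)
    refine ⟨⟨r, hr, hr0, ?_, ?_⟩, hrq, h3, h4⟩
    · rw [← h3, ← mul_assoc, h1]
    · rw [← h4, mul_assoc, h2]
  choose F hF using step
  let P : ℕ → T := fun n => F^[n] ⟨p, hp, hp0, hp.isIdempotentElem, hp.isIdempotentElem⟩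
  have hP : ∀ n, P (n + 1) = F (P n) := fun n => Function.iterate_succ_apply' F n _
  have hle : ∀ n d, (P n).1 * (P (n + d)).1 = (P (n + d)).1 ∧
      (P (n + d)).1 * (P n).1 = (P (n + d)).1 := by
    intro n d
    induction d with
    | zero => exact ⟨(P n).2.1.isIdempotentElem, (P n).2.1.isIdempotentElem⟩
    | succ d ih =>
      obtain ⟨-, h1, h2⟩ := hF (P (n + d))
      rw [← hP] at h1 h2
      change (P n).1 * (P (n + d + 1)).1 = (P (n + d + 1)).1 ∧
        (P (n + d + 1)).1 * (P n).1 = (P (n + d + 1)).1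
      constructor
      · rw [← h1, ← mul_assoc, ih.1]
      · rw [← h2, mul_assoc, ih.2]
  have hle' : ∀ m n, m ≤ n → (P m).1 * (P n).1 = (P n).1 ∧ (P n).1 * (P m).1 = (P n).1 := by
    intro m n hmn
    obtain ⟨d, rfl⟩ := Nat.exists_eq_add_of_le hmn
    exact hle m d
  refine hno ⟨fun n => (P n).1 - (P (n + 1)).1, fun n => ⟨?_, ?_⟩, ?_⟩
  · intro h
    have := (hF (P n)).1
    rw [← hP] at this
    exact this (sub_eq_zero.1 h).symm
  · exact proj_nonneg ((P (n + 1)).2.1.sub_of_mul_eq_left (P n).2.1 (hle' n (n + 1) (by omega)).2)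
  · intro j k hjk
    simp only [sub_mul, mul_sub]
    rcases lt_or_gt_of_ne hjk with h | h
    · rw [(hle' j k (by omega)).1, (hle' j (k + 1) (by omega)).1,
        (hle' (j + 1) k (by omega)).1, (hle' (j + 1) (k + 1) (by omega)).1]
      simp
    · rw [(hle' k j (by omega)).2, (hle' k (j + 1) (by omega)).2,
        (hle' (k + 1) j (by omega)).2, (hle' (k + 1) (j + 1) (by omega)).2]
      simp

/-- Corners between minimal projections are at most one-dimensional. -/
lemma corner_dim {p q : A} (hp : MinProj p) (hq : MinProj q) :
    ∃ v : A, ∀ x : A, ∃ c : ℂ, p * x * q = c • v := by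
  obtain ⟨⟨hpp, hps⟩, hp0, hpm⟩ := hp
  obtain ⟨⟨hqq, hqs⟩, hq0, hqm⟩ := hq
  have hpp : p * p = p := hpp
  have hqq : q * q = q := hqq
  have hps : star p = p := hps
  have hqs : star q = q := hqs
  by_cases hz : ∀ x : A, p * x * q = 0
  · exact ⟨0, fun x => ⟨0, by simp [hz x]⟩⟩
  push Not at hz
  obtain ⟨w, hw⟩ := hz
  refine ⟨p * w * q, fun x => ?_⟩
  obtain ⟨l, hl⟩ := hqm (star w * p * w)
  obtain ⟨m, hm⟩ := hpm (x * q * star w)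
  have hvv : star (p * w * q) * (p * w * q) = l • q := by
    rw [← hl]
    simp only [star_mul, hps, hqs, mul_assoc]
    rw [← mul_assoc p p, hpp]
  have hl0 : l ≠ 0 := by
    rintro rfl
    rw [zero_smul] at hvv
    exact hw (CStarRing.star_mul_self_eq_zero_iff _ |>.1 hvv)
  have hxv : (p * x * q) * star (p * w * q) = m • p := by
    rw [← hm]
    simp only [star_mul, hps, hqs, mul_assoc]
    rw [← mul_assoc q q, hqq]
  have h3 : l • (p * x * q) = m • (p * w * q) := by
    calc l • (p * x * q) = (p * x * q) * (l • q) := by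
          rw [mul_smul_comm, mul_assoc _ q q, hqq]
      _ = ((p * x * q) * star (p * w * q)) * (p * w * q) := by rw [← hvv, ← mul_assoc]
      _ = m • (p * w * q) := by
          rw [hxv, smul_mul_assoc]
          simp only [← mul_assoc, hpp]
  refine ⟨l⁻¹ * m, ?_⟩
  rw [mul_smul, ← h3, smul_smul, inv_mul_cancel₀ hl0, one_smul]

lemma finiteDimensional_of_not [PartialOrder A] [StarOrderedRing A] (hno : ¬ HasOrthSeq A) :
    FiniteDimensional ℂ A := by
  have hfin : ∀ a : A, IsSelfAdjoint a → (quasispectrum ℝ a).Finite := by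
    intro a ha
    by_contra hcon
    exact hno (hasOrthSeq_of_infinite a ha hcon)
  obtain ⟨M, hM⟩ := zorn_subset {S : Set A | (∀ p ∈ S, MinProj p) ∧
      S.Pairwise fun p q => p * q = 0} (by
    intro c hc hchain
    refine ⟨⋃₀ c, ⟨?_, ?_⟩, fun s hs => Set.subset_sUnion_of_mem hs⟩
    · rintro p ⟨S, hS, hpS⟩
      exact (hc hS).1 p hpS
    · exact (Set.pairwise_sUnion hchain.directedOn).2 fun S hS => (hc hS).2)
  obtain ⟨⟨hMmin, hMorth⟩, hMmax⟩ := hM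
  have hMfin : M.Finite := by
    by_contra hinf
    have hinf : M.Infinite := hinf
    let f := hinf.natEmbedding
    refine hno ⟨fun n => (f n).1, fun n => ⟨(hMmin _ (f n).2).2.1,
      proj_nonneg (hMmin _ (f n).2).1⟩, fun j k hjk => hMorth (f j).2 (f k).2 ?_⟩
    exact fun h => hjk (f.injective (Subtype.ext h))
  set N := hMfin.toFinset with hN
  have hmemN : ∀ p, p ∈ N ↔ p ∈ M := by simp [hN]
  set e : A := ∑ p ∈ N, p with he
  have hpe : ∀ p ∈ M, p * e = p := by
    intro p hp
    rw [he, Finset.mul_sum, Finset.sum_eq_single_of_mem p ((hmemN p).2 hp)]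
    · exact (hMmin p hp).1.isIdempotentElem
    · intro q hq hqp
      exact hMorth hp ((hmemN q).1 hq) hqp.symm
  have hes : star e = e := by
    rw [he, star_sum]
    exact Finset.sum_congr rfl fun p hp => (hMmin p ((hmemN p).1 hp)).1.isSelfAdjoint
  have hee : e * e = e := by
    conv_lhs => lhs; rw [he]
    rw [Finset.sum_mul]
    exact Finset.sum_congr rfl fun p hp => hpe p ((hmemN p).1 hp)
  have hleft : ∀ x : A, e * x = x := by
    intro x
    set y := x - e * x with hy
    have hey : e * y = 0 := by rw [hy, mul_sub, ← mul_assoc, hee, sub_self]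
    by_cases hy0 : y * star y = 0
    · have := (CStarRing.mul_star_self_eq_zero_iff _).1 hy0
      exact (sub_eq_zero.1 this).symm
    exfalso
    have hsa : IsSelfAdjoint (y * star y) := IsSelfAdjoint.mul_star_self y
    obtain ⟨q, w, c, hq, hq0, hqe, -⟩ := exists_proj _ hsa hy0 (hfin _ hsa)
    obtain ⟨r, hr, hqr, hrq⟩ := exists_min hno hfin q hq hq0
    have heq : e * q = 0 := by rw [hqe]; simp only [← mul_assoc, hey, zero_mul]
    have her : e * r = 0 := by rw [← hqr, ← mul_assoc, heq, zero_mul]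
    have hpr : ∀ p ∈ M, p * r = 0 := by
      intro p hp
      rw [← hpe p hp, mul_assoc, her, mul_zero]
    have hrp : ∀ p ∈ M, r * p = 0 := by
      intro p hp
      have h1 := congrArg star (hpr p hp)
      rwa [star_mul, star_zero, hr.1.isSelfAdjoint.star_eq,
        (hMmin p hp).1.isSelfAdjoint.star_eq] at h1
    have hins : r ∈ M := by
      refine hMmax (y := insert r M) ⟨?_, ?_⟩ (Set.subset_insert r M) (Set.mem_insert r M)
      · rintro p (rfl | hp)
        · exact hr
        · exact hMmin p hp
      · refine hMorth.insert fun p hp _ => ⟨hrp p hp, hpr p hp⟩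
    have := hpr r hins
    rw [hr.1.isIdempotentElem.eq] at this
    exact hr.2.1 this
  have hright : ∀ x : A, x * e = x := by
    intro x
    have := congrArg star (hleft (star x))
    rwa [star_mul, star_star, hes] at this
  have hcor : ∀ p q : M, ∃ v : A, ∀ x : A, ∃ c : ℂ, p.1 * x * q.1 = c • v :=
    fun p q => corner_dim (hMmin p p.2) (hMmin q q.2)
  choose v hv using hcor
  have : Finite M := hMfin
  refine Module.Finite.of_fg_top ⟨(Set.finite_range fun z : M × M => v z.1 z.2).toFinset, ?_⟩
  rw [eq_top_iff]
  intro x _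
  rw [Set.Finite.coe_toFinset]
  have hx : x = ∑ q ∈ N, ∑ p ∈ N, p * x * q := by
    conv_lhs => rw [← hright x, ← hleft x]
    conv_lhs => rw [he, Finset.mul_sum]
    refine Finset.sum_congr rfl fun q _ => ?_
    rw [Finset.sum_mul, Finset.sum_mul]
  rw [hx]
  refine Submodule.sum_mem _ fun q hq => Submodule.sum_mem _ fun p hp => ?_
  obtain ⟨c, hc⟩ := hv ⟨p, (hmemN p).1 hp⟩ ⟨q, (hmemN q).1 hq⟩ x
  simp only at hc
  rw [hc]
  exact Submodule.smul_mem _ _ (Submodule.subset_span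
    ⟨(⟨p, (hmemN p).1 hp⟩, ⟨q, (hmemN q).1 hq⟩), rfl⟩)

end Helpers

/-- In an infinite-dimensional C*-algebra there is a sequence of non-zero positive
elements that are pairwise orthogonal. -/
theorem infinite_dimensional_orthogonal_positive_sequence
    (A : Type*) [NonUnitalCStarAlgebra A] [PartialOrder A] [StarOrderedRing A]
    (h : ¬ FiniteDimensional ℂ A) :
    ∃ a : ℕ → A, (∀ n, a n ≠ 0 ∧ 0 ≤ a n) ∧ ∀ j k, j ≠ k → a j * a k = 0 := by
  by_contra hno
  exact h (finiteDimensional_of_not hno)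
end

section
/- If A is an infinite-dimensional C*-algebra of real rank zero, then A contains a sequence (p_n) of non-zero projections that are pairwise orthogonal, i.e. p_j · p_k = 0 for j ≠ k. -/
/-- A unital C*-algebra has real rank zero if the self-adjoint elements with finite
spectrum are dense in the set of self-adjoint elements. -/
def RealRankZero (A : Type*) [CStarAlgebra A] : Prop :=
  {a : A | IsSelfAdjoint a} ⊆ closure {a : A | IsSelfAdjoint a ∧ (spectrum ℂ a).Finite}
lemma rrz_proj_norm {A : Type*} [CStarAlgebra A] (p : A) (h1 : star p = p) (h2 : p * p = p) :
    ‖p‖ ≤ 1 := by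
  have h := CStarRing.norm_star_mul_self (x := p)
  rw [h1, h2] at h
  nlinarith [norm_nonneg p]

lemma rrz_spec_proj {A : Type*} [CStarAlgebra A] (x : A) (hx : IsSelfAdjoint x)
    (hfin : (spectrum ℂ x).Finite) :
    ∃ q g : A, star q = q ∧ q * q = q ∧ q = x * g ∧ q = g * x ∧ ‖g‖ ≤ 2 ∧
      ‖x - q * x‖ ≤ 1 / 2 := by
  have hfin' : (spectrum ℝ x).Finite := by
    rw [← spectrum.preimage_algebraMap ℂ]
    exact hfin.preimage (FaithfulSMul.algebraMap_injective ℝ ℂ).injOn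
  have hc : ∀ f : ℝ → ℝ, ContinuousOn f (spectrum ℝ x) := fun f => hfin'.continuousOn f
  classical
  let g : ℝ → ℝ := fun t => if 1 / 2 ≤ |t| then t⁻¹ else 0
  let f : ℝ → ℝ := fun t => if 1 / 2 ≤ |t| then 1 else 0
  have hfg : ∀ t, f t = t * g t := by
    intro t
    by_cases h : 1 / 2 ≤ |t|
    · have : t ≠ 0 := by rintro rfl; norm_num at h
      simp only [f, g, if_pos h]; field_simp
    · simp only [f, g, if_neg h, mul_zero]
  refine ⟨cfc f x, cfc g x, ?_, ?_, ?_, ?_, ?_, ?_⟩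
  · exact (cfc_predicate f x : IsSelfAdjoint _)
  · rw [← cfc_mul f f x (hc _) (hc _)]
    congr 1; funext t; simp [f]
  · have e := cfc_mul (fun t : ℝ => t) g x (hc _) (hc _)
    rw [cfc_id' ℝ x] at e
    rw [← e]; congr 1; funext t; exact hfg t
  · have e := cfc_mul g (fun t : ℝ => t) x (hc _) (hc _)
    rw [cfc_id' ℝ x] at e
    rw [← e]; congr 1; funext t; rw [hfg t, mul_comm]
  · refine norm_cfc_le (by norm_num) fun t _ => ?_
    by_cases h : 1 / 2 ≤ |t|
    · simp only [g, if_pos h, norm_inv, Real.norm_eq_abs]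
      rw [inv_le_comm₀ (by linarith) (by norm_num)]; linarith
    · simp only [g, if_neg h, norm_zero]; norm_num
  · have : x - cfc f x * x = cfc (fun t => t - f t * t) x := by
      rw [cfc_sub _ _ x (hc _) (hc _), cfc_mul _ _ x (hc _) (hc _), cfc_id' ℝ x]
    rw [this]
    refine norm_cfc_le (by norm_num) fun t _ => ?_
    by_cases h : 1 / 2 ≤ |t|
    · simp only [f, if_pos h, one_mul, sub_self, norm_zero]; norm_num
    · simp only [f, if_neg h, Real.norm_eq_abs]; push Not at h; simp; linarith

lemma rrz_near_proj {A : Type*} [CStarAlgebra A] (y : A) (hy : IsSelfAdjoint y)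
    (hn : ‖y * y - y‖ < 1 / 4) :
    ∃ q g : A, star q = q ∧ q * q = q ∧ q = y * g ∧ ‖q - y‖ ≤ 2 * ‖y * y - y‖ := by
  have hb : ∀ t ∈ spectrum ℝ y, |t * t - t| ≤ ‖y * y - y‖ := by
    intro t ht
    have h1 : y * y - y = cfc (fun t : ℝ => t * t - t) y := by
      rw [cfc_sub _ _ y, cfc_mul _ _ y, cfc_id' ℝ y]
    rw [h1]
    exact norm_apply_le_norm_cfc (fun t : ℝ => t * t - t) y ht
  have hne : ∀ t ∈ spectrum ℝ y, t ≠ 1 / 2 := by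
    rintro t ht rfl
    have := hb _ ht
    norm_num [abs_of_neg] at this
    linarith
  classical
  let g : ℝ → ℝ := fun t => if 1 / 2 < t then t⁻¹ else 0
  let f : ℝ → ℝ := fun t => if 1 / 2 < t then 1 else 0
  have hg : ContinuousOn g (spectrum ℝ y) := by
    intro t ht
    apply ContinuousAt.continuousWithinAt
    rcases lt_or_gt_of_ne (hne t ht) with h | h
    · have : g =ᶠ[nhds t] fun _ => 0 := by
        filter_upwards [Iio_mem_nhds h] with s hs
        simp only [g]; rw [if_neg (not_lt.2 (le_of_lt hs))]
      exact continuousAt_const.congr this.symm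
    · have : g =ᶠ[nhds t] fun s => s⁻¹ := by
        filter_upwards [Ioi_mem_nhds h] with s hs
        simp only [g]; rw [if_pos (Set.mem_Ioi.1 hs)]
      exact (continuousAt_inv₀ (by linarith)).congr this.symm
  have hfg : ∀ t, f t = t * g t := by
    intro t
    by_cases h : 1 / 2 < t
    · have : t ≠ 0 := by linarith
      simp only [f, g, if_pos h]; field_simp
    · simp only [f, g, if_neg h, mul_zero]
  have hf : ContinuousOn f (spectrum ℝ y) := by
    have : f = fun t => t * g t := funext hfg
    rw [this]; exact continuousOn_id.mul hg
  refine ⟨cfc f y, cfc g y, (cfc_predicate f y : IsSelfAdjoint _), ?_, ?_, ?_⟩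
  · rw [← cfc_mul f f y hf hf]
    congr 1; funext t; simp [f]
  · have e := cfc_mul (fun t : ℝ => t) g y continuousOn_id hg
    rw [cfc_id' ℝ y] at e
    rw [← e]; congr 1; funext t; exact hfg t
  · have : cfc f y - y = cfc (fun t => f t - t) y := by
      rw [cfc_sub f (fun t : ℝ => t) y hf continuousOn_id, cfc_id' ℝ y]
    rw [this]
    refine norm_cfc_le (by positivity) fun t ht => ?_
    refine le_trans ?_ (mul_le_mul_of_nonneg_left (hb t ht) (by norm_num))
    have e : |t * t - t| = |t| * |1 - t| := by
      rw [← abs_mul, ← abs_neg]; congr 1; ring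
    rw [e, Real.norm_eq_abs]
    by_cases h : 1 / 2 < t
    · simp only [f, if_pos h]; rw [abs_of_pos (by linarith : 0 < t)]
      nlinarith [abs_nonneg (1 - t)]
    · simp only [f, if_neg h]; rw [abs_of_pos (by linarith : 0 < 1 - t), zero_sub, abs_neg]
      nlinarith [abs_nonneg t]

lemma rrz_split {A : Type*} [CStarAlgebra A] (hrr0 : RealRankZero A) (p b c : A)
    (hp : star p = p) (hpp : p * p = p) (hb : IsSelfAdjoint b) (hb1 : ‖b‖ = 1) (hc1 : ‖c‖ = 1)
    (hpb : p * b = b) (hbp : b * p = b) (hpc : p * c = c) (hbc : b * c = 0) :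
    ∃ q : A, star q = q ∧ q * q = q ∧ p * q = q ∧ q ≠ 0 ∧ q ≠ p := by
  obtain ⟨x, ⟨hx, hxf⟩, hxb⟩ := Metric.mem_closure_iff.1 (hrr0 hb) (1 / 100) (by norm_num)
  rw [dist_eq_norm] at hxb
  obtain ⟨q, g, hq, hqq, hxg, hgx, hg, hxq⟩ := rrz_spec_proj x hx hxf
  have hqn := rrz_proj_norm q hq hqq
  have hpn := rrz_proj_norm p hp hpp
  have hpcn := rrz_proj_norm (1 - p) (by simp [hp]) (by simp [sub_mul, mul_sub, hpp])
  have hqcn := rrz_proj_norm (1 - q) (by simp [hq]) (by simp [sub_mul, mul_sub, hqq])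
  have hxb' : ‖x - b‖ ≤ 1 / 100 := by rw [norm_sub_rev]; exact hxb.le
  have h1 : ‖(1 - p) * q‖ ≤ 1 / 50 := by
    have : (1 - p) * q = (1 - p) * ((x - b) * g) := by
      rw [sub_mul x, ← hxg, mul_sub, ← mul_assoc (1 - p) b]; simp [sub_mul, hpb]
    rw [this]
    calc _ ≤ ‖1 - p‖ * (‖x - b‖ * ‖g‖) :=
          (norm_mul_le _ _).trans (by gcongr; exact norm_mul_le _ _)
      _ ≤ 1 * (1 / 100 * 2) := by gcongr
      _ = _ := by norm_num
  have h2 : ‖q * (1 - p)‖ ≤ 1 / 50 := by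
    rw [← norm_star]; simpa [hq, hp] using h1
  have h3 : ‖q - p * q * p‖ ≤ 1 / 25 := by
    have : q - p * q * p = (1 - p) * q + p * (q * (1 - p)) := by noncomm_ring
    rw [this]
    calc _ ≤ ‖(1 - p) * q‖ + ‖p‖ * ‖q * (1 - p)‖ :=
          (norm_add_le _ _).trans (by gcongr; exact norm_mul_le _ _)
      _ ≤ 1 / 50 + 1 * (1 / 50) := by gcongr
      _ = _ := by norm_num
  have h4 : ‖p * q * p * (p * q * p) - p * q * p‖ ≤ 1 / 50 := by
    have : p * q * p * (p * q * p) - p * q * p = - (p * q * ((1 - p) * q) * p) := by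
      have e1 : p * q * p * (p * q * p) = p * q * (p * p) * q * p := by noncomm_ring
      have e2 : p * q * ((1 - p) * q) * p = p * (q * q) * p - p * q * p * q * p := by
        noncomm_ring
      rw [e1, e2, hpp, hqq]; abel
    rw [this, norm_neg]
    calc _ ≤ ‖p‖ * ‖q‖ * ‖(1 - p) * q‖ * ‖p‖ := by
          refine (norm_mul_le _ _).trans ?_
          gcongr
          refine (norm_mul_le _ _).trans ?_
          gcongr
          exact norm_mul_le _ _
      _ ≤ 1 * 1 * (1 / 50) * 1 := by gcongr
      _ = _ := by norm_num
  have hy : IsSelfAdjoint (p * q * p) := by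
    simp [IsSelfAdjoint, hp, hq, mul_assoc]
  obtain ⟨r, k, hr, hrr, hrk, hrn⟩ := rrz_near_proj (p * q * p) hy (by linarith)
  have h5 : ‖q - r‖ ≤ 2 / 25 := by
    have : q - r = (q - p * q * p) - (r - p * q * p) := by abel
    rw [this]
    refine (norm_sub_le _ _).trans ?_
    linarith
  refine ⟨r, hr, hrr, ?_, ?_, ?_⟩
  · rw [hrk]; simp only [← mul_assoc, hpp]
  · rintro rfl
    rw [sub_zero] at h5
    have : b = (1 - q) * (b - x) + (x - q * x) + q * b := by noncomm_ring
    have h6 : ‖b‖ ≤ 1 * (1 / 100) + 1 / 2 + 2 / 25 * 1 := by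
      conv_lhs => rw [this]
      calc _ ≤ ‖1 - q‖ * ‖b - x‖ + ‖x - q * x‖ + ‖q‖ * ‖b‖ :=
            (norm_add₃_le).trans (by gcongr <;> exact norm_mul_le _ _)
        _ ≤ _ := by gcongr; exact hb1.le
    rw [hb1] at h6; norm_num at h6
  · rintro rfl
    have : c = g * ((x - b) * c) - (q - r) * c := by
      rw [sub_mul x, hbc, sub_zero, ← mul_assoc, ← hgx, sub_mul, hpc]; abel
    have h6 : ‖c‖ ≤ 2 * (1 / 100 * 1) + 2 / 25 * 1 := by
      conv_lhs => rw [this]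
      calc _ ≤ ‖g‖ * (‖x - b‖ * ‖c‖) + ‖q - r‖ * ‖c‖ := by
            refine (norm_sub_le _ _).trans ?_
            gcongr
            · refine (norm_mul_le _ _).trans ?_
              gcongr
              exact norm_mul_le _ _
            · exact norm_mul_le _ _
        _ ≤ _ := by gcongr <;> exact hc1.le
    rw [hc1] at h6; norm_num at h6

/-- minimal (possibly zero) projection -/
def RRZMin {A : Type*} [CStarAlgebra A] (p : A) : Prop :=
  star p = p ∧ p * p = p ∧ ∀ q : A, star q = q → q * q = q → p * q = q → q = 0 ∨ q = p

lemma rrz_dichotomy {A : Type*} [CStarAlgebra A] (hrr0 : RealRankZero A) (p : A) (hp : RRZMin p)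
    (d : A) (hd : IsSelfAdjoint d) (hpd : p * d = d) : d⁺ = 0 ∨ d⁻ = 0 := by
  obtain ⟨h1, h2, h3⟩ := hp
  have hdp : d * p = d := by
    have := congrArg star hpd
    simpa [hd.star_eq, h1] using this
  have key : ∀ u : A, IsSelfAdjoint u → u * u * p = u * u → u * p = u := by
    intro u hu huu
    have : star (u - u * p) * (u - u * p) = 0 := by
      have e : star (u - u * p) * (u - u * p) = (1 - p) * (u * u - u * u * p) := by
        simp only [star_sub, star_mul, hu.star_eq, h1]; noncomm_ring
      rw [e, huu, sub_self, mul_zero]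
    have := (CStarRing.star_mul_self_eq_zero_iff _).1 this
    exact (sub_eq_zero.1 this).symm
  have hs := CFC.posPart_sub_negPart d hd
  have hpn := CFC.posPart_mul_negPart d
  have hnp := CFC.negPart_mul_posPart d
  have hsp : IsSelfAdjoint d⁺ := cfcₙ_predicate _ _
  have hsn : IsSelfAdjoint d⁻ := cfcₙ_predicate _ _
  have e1 : d⁺ * d⁺ = d⁺ * d := by
    have := congrArg (d⁺ * ·) hs
    simp only [mul_sub, hpn, sub_zero] at this
    exact this
  have e2 : d⁻ * d⁻ = - (d⁻ * d) := by
    have := congrArg (d⁻ * ·) hs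
    simp only [mul_sub, hnp, zero_sub] at this
    rw [← this, neg_neg]
  have k1 : d⁺ * p = d⁺ := key _ hsp (by rw [e1, mul_assoc, hdp])
  have k2 : d⁻ * p = d⁻ := key _ hsn (by rw [e2, neg_mul, mul_assoc, hdp])
  have k1' : p * d⁺ = d⁺ := by
    have := congrArg star k1
    simpa [hsp.star_eq, h1] using this
  have k2' : p * d⁻ = d⁻ := by
    have := congrArg star k2
    simpa [hsn.star_eq, h1] using this
  by_contra! hcon
  obtain ⟨c1, c2⟩ := hcon
  obtain ⟨q, q1, q2, q3, q4, q5⟩ := rrz_split hrr0 p ((‖d⁺‖⁻¹ : ℝ) • d⁺) ((‖d⁻‖⁻¹ : ℝ) • d⁻)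
    h1 h2 (by simp [IsSelfAdjoint, hsp.star_eq]) (by simp [norm_smul, norm_ne_zero_iff.2 c1])
    (by simp [norm_smul, norm_ne_zero_iff.2 c2]) (by simp [k1']) (by simp [k1]) (by simp [k2'])
    (by simp [hpn])
  rcases h3 q q1 q2 q3 with h | h
  · exact q4 h
  · exact q5 h

lemma rrz_scalar_sa {A : Type*} [CStarAlgebra A] (hrr0 : RealRankZero A) (p : A) (hp : RRZMin p)
    (a : A) (ha : IsSelfAdjoint a) (hpa : p * a = a) : ∃ r : ℝ, a = r • p := by
  let _ := CStarAlgebra.spectralOrder A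
  have := CStarAlgebra.spectralOrderedRing A
  have h1 := hp.1
  have h2 := hp.2.1
  have hap : a * p = a := by
    have := congrArg star hpa
    simpa [ha.star_eq, h1] using this
  have hcov : (Set.univ : Set ℝ) ⊆ {r : ℝ | r • p ≤ a} ∪ {r : ℝ | a ≤ r • p} := by
    intro r _
    have hd : IsSelfAdjoint (a - r • p) := by simp [IsSelfAdjoint, ha.star_eq, h1]
    have := rrz_dichotomy hrr0 p hp (a - r • p) hd (by simp [mul_sub, hpa, h2])
    rcases this with h | h
    · right
      simpa using (CFC.posPart_eq_zero_iff _ hd).1 h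
    · left
      simpa using (CFC.negPart_eq_zero_iff _ hd).1 h
  have hcl1 : IsClosed {r : ℝ | r • p ≤ a} := isClosed_le (by fun_prop) continuous_const
  have hcl2 : IsClosed {r : ℝ | a ≤ r • p} := isClosed_le continuous_const (by fun_prop)
  have n1 : -‖a‖ • p ≤ a := by
    have := star_left_conjugate_le_conjugate ha.neg_algebraMap_norm_le_self p
    rw [h1] at this
    simpa [hpa, hap, h2, Algebra.algebraMap_eq_smul_one] using this
  have n2 : a ≤ ‖a‖ • p := by
    have := star_left_conjugate_le_conjugate ha.le_algebraMap_norm_self p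
    rw [h1] at this
    simpa [hpa, hap, h2, Algebra.algebraMap_eq_smul_one] using this
  obtain ⟨r, -, hr1, hr2⟩ := isPreconnected_closed_iff.1 (isPreconnected_univ (α := ℝ)) _ _
    hcl1 hcl2 hcov ⟨_, trivial, n1⟩ ⟨_, trivial, n2⟩
  exact ⟨r, le_antisymm hr2 hr1⟩

lemma rrz_scalar {A : Type*} [CStarAlgebra A] (hrr0 : RealRankZero A) (p : A) (hp : RRZMin p)
    (a : A) : ∃ r : ℂ, p * a * p = r • p := by
  have h1 := hp.1
  have h2 := hp.2.1
  have hs : ∀ b : A, IsSelfAdjoint b → ∃ r : ℝ, p * b * p = r • p := by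
    intro b hb
    refine rrz_scalar_sa hrr0 p hp _ ?_ ?_
    · simp [IsSelfAdjoint, h1, hb.star_eq, mul_assoc]
    · simp only [← mul_assoc, h2]
  obtain ⟨r, hr⟩ := hs (realPart a) (realPart a).2
  obtain ⟨s, hs⟩ := hs (imaginaryPart a) (imaginaryPart a).2
  refine ⟨r + Complex.I * s, ?_⟩
  conv_lhs => rw [← realPart_add_I_smul_imaginaryPart a]
  rw [mul_add, add_mul, hr, mul_smul_comm, smul_mul_assoc, hs, add_smul, mul_smul]
  simp only [Complex.coe_smul]

lemma rrz_corner {A : Type*} [CStarAlgebra A] (hrr0 : RealRankZero A) (p q : A) (hp : RRZMin p)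
    (hq : RRZMin q) : ∃ x : A, ∀ a, ∃ r : ℂ, p * a * q = r • x := by
  by_cases h : ∀ a, p * a * q = 0
  · exact ⟨0, fun a => ⟨0, by simp [h a]⟩⟩
  push Not at h
  obtain ⟨b, hb⟩ := h
  refine ⟨p * b * q, fun a => ?_⟩
  have p1 := hp.1
  have p2 := hp.2.1
  have q1 := hq.1
  have q2 := hq.2.1
  obtain ⟨s, hs⟩ := rrz_scalar hrr0 p hp (b * q * star b)
  obtain ⟨t, ht⟩ := rrz_scalar hrr0 q hq (star b * p * a)
  have hs' : p * b * q * star (p * b * q) = s • p := by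
    rw [← hs]; simp only [star_mul, p1, q1]
    calc _ = p * b * (q * q) * star b * p := by noncomm_ring
      _ = _ := by rw [q2]; noncomm_ring
  have hs0 : s ≠ 0 := by
    rintro rfl
    rw [zero_smul] at hs'
    exact hb ((CStarRing.mul_star_self_eq_zero_iff _).1 hs')
  have ht' : star (p * b * q) * (p * a * q) = t • q := by
    rw [← ht]; simp only [star_mul, p1, q1]
    calc _ = q * star b * (p * p) * a * q := by noncomm_ring
      _ = _ := by rw [p2]; noncomm_ring
  have e : s • (p * a * q) = t • (p * b * q) := by
    calc s • (p * a * q) = (s • p) * (p * a * q) := by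
          rw [smul_mul_assoc, ← mul_assoc, ← mul_assoc, p2]
      _ = (p * b * q) * (t • q) := by rw [← hs', ← ht', mul_assoc]
      _ = _ := by rw [mul_smul_comm, mul_assoc, q2]
  refine ⟨s⁻¹ * t, ?_⟩
  rw [mul_smul, ← e, smul_smul, inv_mul_cancel₀ hs0, one_smul]

lemma rrz_findim {A : Type*} [CStarAlgebra A] (hrr0 : RealRankZero A) (L : List A)
    (hL : ∀ p ∈ L, RRZMin p) (h1 : L.sum = 1) : FiniteDimensional ℂ A := by
  have hx : ∀ i j : Fin L.length, ∃ x : A, ∀ a, ∃ r : ℂ, L[i] * a * L[j] = r • x := fun i j =>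
    rrz_corner hrr0 _ _ (hL _ (L.getElem_mem _)) (hL _ (L.getElem_mem _))
  choose x hx using hx
  have hsum : ∑ i : Fin L.length, L[i] = 1 := by
    rw [← h1]; simp [Fin.sum_univ_getElem]
  refine ⟨⟨(Set.finite_range fun ij : Fin L.length × Fin L.length => x ij.1 ij.2).toFinset, ?_⟩⟩
  rw [Set.Finite.coe_toFinset, eq_top_iff]
  intro a _
  have : a = ∑ i : Fin L.length, ∑ j : Fin L.length, L[i] * a * L[j] := by
    simp_rw [← Finset.mul_sum, hsum, mul_one, ← Finset.sum_mul, hsum, one_mul]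
  rw [this]
  refine Submodule.sum_mem _ fun i _ => Submodule.sum_mem _ fun j _ => ?_
  obtain ⟨r, hr⟩ := hx i j a
  rw [hr]
  exact Submodule.smul_mem _ _ (Submodule.subset_span ⟨(i, j), rfl⟩)

lemma rrz_chain {A : Type*} [CStarAlgebra A] (f : ℕ → A)
    (hs : ∀ n, star (f n) = f n) (hm : ∀ n, f n * f n = f n)
    (hle : ∀ n, f n * f (n + 1) = f (n + 1)) (hne : ∀ n, f (n + 1) ≠ f n) :
    ∃ p : ℕ → A, (∀ n, p n ≠ 0 ∧ star (p n) = p n ∧ p n * p n = p n) ∧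
      ∀ j k, j ≠ k → p j * p k = 0 := by
  have hle' : ∀ n k, f n * f (n + k) = f (n + k) := by
    intro n k
    induction k with
    | zero => exact hm n
    | succ k ih => rw [← add_assoc, ← hle (n + k), ← mul_assoc, ih]
  have hle2 : ∀ n m, n ≤ m → f n * f m = f m := by
    intro n m h
    obtain ⟨k, rfl⟩ := Nat.exists_eq_add_of_le h
    exact hle' n k
  have hle3 : ∀ n m, n ≤ m → f m * f n = f m := by
    intro n m h
    have := congrArg star (hle2 n m h)
    simpa [hs] using this
  have hst : ∀ n, star (f n - f (n + 1)) = f n - f (n + 1) := by intro n; simp [hs]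
  have horth : ∀ j k, j < k → (f j - f (j + 1)) * (f k - f (k + 1)) = 0 := by
    intro j k h
    simp [sub_mul, mul_sub, hle2 j k h.le, hle2 j (k + 1) (by omega), hle2 (j + 1) k h,
      hle2 (j + 1) (k + 1) (by omega)]
  refine ⟨fun n => f n - f (n + 1), fun n => ⟨?_, hst n, ?_⟩, ?_⟩
  · exact fun h => hne n (sub_eq_zero.1 h).symm
  · simp [sub_mul, mul_sub, hm, hle n, hle3 n (n + 1) (by omega)]
  · intro j k hjk
    rcases lt_or_gt_of_ne hjk with h | h
    · exact horth j k h
    · have := congrArg star (horth k j h)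
      rw [star_mul, hst, hst, star_zero] at this
      exact this

/-- An infinite-dimensional real rank zero C*-algebra contains a sequence of non-zero
pairwise orthogonal projections. -/
theorem real_rank_zero_infinite_dimensional_orthogonal_projections
    (A : Type*) [CStarAlgebra A]
    (hinf : ¬ FiniteDimensional ℂ A) (hrr0 : RealRankZero A) :
    ∃ p : ℕ → A, (∀ n, p n ≠ 0 ∧ star (p n) = p n ∧ p n * p n = p n) ∧
      ∀ j k, j ≠ k → p j * p k = 0 := by
  by_contra hcon
  apply hinf
  let R : A → A → Prop := fun q p =>
    star q = q ∧ q * q = q ∧ star p = p ∧ p * p = p ∧ p * q = q ∧ q ≠ p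
  have hwf : WellFounded R := by
    rw [wellFounded_iff_isEmpty_descending_chain]
    refine ⟨fun ⟨f, hf⟩ => hcon (rrz_chain f ?_ ?_ ?_ ?_)⟩
    · exact fun n => (hf n).2.2.1
    · exact fun n => (hf n).2.2.2.1
    · exact fun n => (hf n).2.2.2.2.1
    · exact fun n => (hf n).2.2.2.2.2
  have hmain : ∀ p : A, star p = p → p * p = p →
      ∃ L : List A, (∀ e ∈ L, RRZMin e) ∧ L.sum = p := by
    intro p
    induction p using hwf.induction with
    | _ p ih =>
    intro h1 h2
    by_cases hmin : RRZMin p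
    · exact ⟨[p], by simpa using hmin, by simp⟩
    · have : ∃ q : A, star q = q ∧ q * q = q ∧ p * q = q ∧ q ≠ 0 ∧ q ≠ p := by
        by_contra! hc
        refine hmin ⟨h1, h2, fun q a b c => ?_⟩
        by_cases h0 : q = 0
        · exact Or.inl h0
        · exact Or.inr (hc q a b c h0)
      obtain ⟨q, q1, q2, q3, q4, q5⟩ := this
      have q3' : q * p = q := by
        have := congrArg star q3
        simpa [q1, h1] using this
      have s1 : star (p - q) = p - q := by simp [q1, h1]
      have s2 : (p - q) * (p - q) = p - q := by simp [sub_mul, mul_sub, h2, q2, q3, q3']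
      obtain ⟨L1, a1, b1⟩ := ih q ⟨q1, q2, h1, h2, q3, q5⟩ q1 q2
      obtain ⟨L2, a2, b2⟩ := ih (p - q)
        ⟨s1, s2, h1, h2, by simp [mul_sub, h2, q3], by simpa using q4⟩ s1 s2
      refine ⟨L1 ++ L2, ?_, by simp [b1, b2]⟩
      intro e he
      rcases List.mem_append.1 he with h | h
      · exact a1 e h
      · exact a2 e h
  obtain ⟨L, hL, hs⟩ := hmain 1 (by simp) (by simp)
  exact rrz_findim hrr0 L hL hs
end

section
/- If G is a finitely generated elementary amenable group whose full group C*-algebra C*(G) has real rank zero, then G is finite. -/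
universe u

/-- The class of elementary amenable groups: the smallest class of groups containing all
abelian groups and all finite groups and closed under taking subgroups (more generally,
injective images), quotients (more generally, surjective images), extensions and directed
unions (inductive limits). -/
inductive ElementaryAmenable : ∀ (G : Type u) [Group G], Prop
  | of_comm (G : Type u) [Group G] (h : ∀ a b : G, a * b = b * a) : ElementaryAmenable G
  | of_finite (G : Type u) [Group G] (h : Finite G) : ElementaryAmenable G
  | of_injective (G H : Type u) [Group G] [Group H] (f : G →* H)
      (hf : Function.Injective f) (hH : ElementaryAmenable H) : ElementaryAmenable G
  | of_surjective (G H : Type u) [Group G] [Group H] (f : G →* H)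
      (hf : Function.Surjective f) (hG : ElementaryAmenable G) : ElementaryAmenable H
  | of_extension (G : Type u) [Group G] (N : Subgroup G) (hN : N.Normal)
      (h₁ : ElementaryAmenable N) (h₂ : ElementaryAmenable (G ⧸ N)) : ElementaryAmenable G
  | of_directed_union (G : Type u) [Group G] {ι : Type u} (S : ι → Subgroup G)
      (hdir : Directed (· ≤ ·) S) (hunion : ∀ g : G, ∃ i, g ∈ S i)
      (h : ∀ i, ElementaryAmenable (S i)) : ElementaryAmenable G

/-- `H` virtually maps nontrivially to `ℤ`. -/
def VirtZ (H : Type) [Group H] : Prop :=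
  ∃ K : Subgroup H, K.FiniteIndex ∧ ∃ χ : K →* Multiplicative ℤ, ∃ k, χ k ≠ 1

/-- Every infinite finitely generated subquotient virtually maps nontrivially to `ℤ`. -/
def SubQ (G : Type) [Group G] : Prop :=
  ∀ (L H : Type) [Group L] [Group H] (i : L →* G) (f : L →* H), Function.Injective i →
    Function.Surjective f → Group.FG H → Infinite H → VirtZ H

lemma virtZ_of_surjective {H Q : Type} [Group H] [Group Q] (f : H →* Q)
    (hf : Function.Surjective f) (h : VirtZ Q) : VirtZ H := by
  obtain ⟨K, hK, χ, ⟨k, hkK⟩, hk⟩ := h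
  obtain ⟨x, rfl⟩ := hf k
  refine ⟨K.comap f, ⟨?_⟩, χ.comp (f.subgroupComap K), ⟨x, hkK⟩, hk⟩
  rw [Subgroup.index_comap_of_surjective K hf]
  exact hK.index_ne_zero

lemma virtZ_of_finiteIndex {H : Type} [Group H] (M : Subgroup H) [hM : M.FiniteIndex]
    (h : VirtZ M) : VirtZ H := by
  obtain ⟨K, hK, χ, k, hk⟩ := h
  let e := K.equivMapOfInjective M.subtype M.subtype_injective
  refine ⟨K.map M.subtype, ⟨?_⟩, χ.comp e.symm.toMonoidHom, e k, by simpa using hk⟩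
  rw [Subgroup.index_map_subtype]
  exact mul_ne_zero hK.index_ne_zero hM.index_ne_zero

lemma virtZ_of_comm {H : Type} [Group H] (hc : ∀ a b : H, a * b = b * a)
    (hfg : Group.FG H) (hinf : Infinite H) : VirtZ H := by
  let inst : CommGroup H := { (inferInstance : Group H) with mul_comm := hc }
  obtain ⟨ι, j, hι, hj, p, hp, e, ⟨E⟩⟩ :=
    CommGroup.equiv_free_prod_prod_multiplicative_zmod H
  have : Nonempty j := by
    by_contra hne
    rw [not_nonempty_iff] at hne
    have : ∀ i, NeZero (p i ^ e i) := fun i => ⟨pow_ne_zero _ (hp i).ne_zero⟩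
    have : ∀ i, Finite (Multiplicative (ZMod (p i ^ e i))) := fun i =>
      inferInstanceAs (Finite (ZMod (p i ^ e i)))
    have : Finite H := Finite.of_equiv _ E.symm.toEquiv
    exact not_finite H
  obtain ⟨j0⟩ := this
  let χ : H →* Multiplicative ℤ :=
    ((Pi.evalMonoidHom (fun _ : j => Multiplicative ℤ) j0).comp (MonoidHom.fst _ _)).comp
      E.toMonoidHom
  refine ⟨⊤, inferInstance, χ.comp (Subgroup.subtype ⊤),
    ⟨E.symm (fun _ => Multiplicative.ofAdd 1, 1), trivial⟩, ?_⟩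
  change (E (E.symm (fun _ => Multiplicative.ofAdd 1, 1))).1 j0 ≠ 1
  rw [MulEquiv.apply_symm_apply]
  change (Multiplicative.ofAdd (1 : ℤ)) ≠ 1
  decide

lemma subQ_of_extension (G : Type) [Group G] (N : Subgroup G) (hN : N.Normal)
    (h₁ : SubQ N) (h₂ : SubQ (G ⧸ N)) : SubQ G := by
  intro L H _ _ i f hi hf hfg hinf
  let P := N.comap i
  have hP : P.Normal := hN.comap i
  let M := P.map f
  have hM : M.Normal := hP.map f hf
  by_cases hfin : Infinite (H ⧸ M)
  · refine virtZ_of_surjective (QuotientGroup.mk' M) (QuotientGroup.mk'_surjective M) ?_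
    refine h₂ (L ⧸ P) (H ⧸ M) (QuotientGroup.map P N i le_rfl)
      (QuotientGroup.map P M f (Subgroup.le_comap_map f P)) ?_ ?_ inferInstance hfin
    · rw [injective_iff_map_eq_one]
      intro a
      induction a using QuotientGroup.induction_on with
      | H z =>
        intro hz
        rw [QuotientGroup.map_mk, QuotientGroup.eq_one_iff] at hz
        rw [QuotientGroup.eq_one_iff]
        exact hz
    · intro a
      induction a using QuotientGroup.induction_on with
      | H z =>
        obtain ⟨l, rfl⟩ := hf z
        exact ⟨(l : L ⧸ P), rfl⟩
  · rw [not_infinite_iff_finite] at hfin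
    have : M.FiniteIndex := Subgroup.finiteIndex_of_finite_quotient
    refine virtZ_of_finiteIndex M ?_
    refine h₁ P M (i.subgroupComap N) (f.subgroupMap P) ?_ (f.subgroupMap_surjective P)
      inferInstance ?_
    · intro a b hab
      exact Subtype.ext (hi (congrArg Subtype.val hab))
    · by_contra hcon
      rw [not_infinite_iff_finite] at hcon
      have : Finite H := (Subgroup.finite_iff_finite_and_finiteIndex (H := M)).2 ⟨hcon, this⟩
      exact not_finite H

lemma subQ_of_union (G : Type) [Group G] {ι : Type} (S : ι → Subgroup G)
    (hdir : Directed (· ≤ ·) S) (hunion : ∀ g : G, ∃ i, g ∈ S i)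
    (h : ∀ i, SubQ (S i)) : SubQ G := by
  intro L H _ _ i f hi hf hfg hinf
  obtain ⟨T, hT⟩ := hfg.out
  classical
  choose s hs using hf
  choose c hc using fun x : H => hunion (i (s x))
  have : Nonempty ι := ⟨(hunion 1).choose⟩
  obtain ⟨k, hk⟩ := hdir.finset_le (T.image c)
  let L' := (S k).comap i
  refine h k L' H (i.subgroupComap (S k)) (f.comp L'.subtype) ?_ ?_ ⟨⟨T, hT⟩⟩ hinf
  · intro a b hab
    exact Subtype.ext (hi (congrArg Subtype.val hab))
  · rw [← MonoidHom.range_eq_top, eq_top_iff, ← hT, Subgroup.closure_le]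
    intro x hx
    exact ⟨⟨s x, hk _ (Finset.mem_image_of_mem c hx) (hc x)⟩, hs x⟩

lemma subQ_of_elementaryAmenable (G : Type) [Group G] (h : ElementaryAmenable G) : SubQ G := by
  induction h with
  | of_comm G h =>
    intro L H _ _ i f hi hf hfg hinf
    refine virtZ_of_comm (fun a b => ?_) hfg hinf
    obtain ⟨a, rfl⟩ := hf a
    obtain ⟨b, rfl⟩ := hf b
    rw [← map_mul, ← map_mul]
    congr 1
    apply hi
    rw [map_mul, map_mul, h]
  | of_finite G h =>
    intro L H _ _ i f hi hf hfg hinf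
    have := Finite.of_injective i hi
    have := Finite.of_surjective f hf
    exact (not_finite H).elim
  | of_injective G H f hf hH ih =>
    intro L Q _ _ i g hi hg
    exact ih L Q (f.comp i) g (hf.comp hi) hg
  | of_surjective G H f hf hG ih =>
    intro L Q _ _ i g hi hg
    let R := i.range.comap f
    let e := i.ofInjective hi
    refine ih R Q R.subtype (g.comp (e.symm.toMonoidHom.comp (f.subgroupComap i.range)))
      R.subtype_injective (hg.comp (e.symm.surjective.comp ?_))
    rintro ⟨x, hx⟩
    obtain ⟨y, rfl⟩ := hf x
    exact ⟨⟨y, hx⟩, rfl⟩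
  | of_extension G N hN h₁ h₂ ih₁ ih₂ => exact subQ_of_extension G N hN ih₁ ih₂
  | of_directed_union G S hdir hunion h ih => exact subQ_of_union G S hdir hunion ih


section rep
variable {G X : Type} [Group G] [MulAction G X] [Fintype X] [DecidableEq X]

/-- The monomial matrix attached to a cocycle. -/
noncomputable def monoMat {D : Type} [CommCStarAlgebra D] (w : unitary D) (c : G → X → ℤ) (g : G) :
    CStarMatrix X X D :=
  CStarMatrix.ofMatrix (Matrix.of fun y x => if y = g • x then ((w ^ c g x : unitary D) : D) else 0)

lemma monoMat_apply {D : Type} [CommCStarAlgebra D] (w : unitary D) (c : G → X → ℤ) (g : G)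
    (x y : X) :
    monoMat w c g y x = if y = g • x then ((w ^ c g x : unitary D) : D) else 0 := rfl

lemma monoMat_one {D : Type} [CommCStarAlgebra D] (w : unitary D) (c : G → X → ℤ)
    (hc : ∀ g h x, c (g * h) x = c g (h • x) + c h x) : monoMat w c (1 : G) = 1 := by
  ext y x
  have h1 : c 1 x = 0 := by simpa using hc 1 1 x
  rw [monoMat_apply, CStarMatrix.one_apply, one_smul, h1]
  simp

lemma monoMat_mul {D : Type} [CommCStarAlgebra D] (w : unitary D) (c : G → X → ℤ)
    (hc : ∀ g h x, c (g * h) x = c g (h • x) + c h x) (g h : G) :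
    monoMat w c (g * h) = monoMat w c g * monoMat w c h := by
  ext y x
  rw [CStarMatrix.mul_apply, Finset.sum_eq_single (h • x)]
  · simp only [monoMat_apply, if_true, hc, zpow_add, mul_smul]
    split_ifs <;> simp
  · intro z _ hz
    simp [monoMat_apply, hz]
  · simp

lemma monoMat_star {D : Type} [CommCStarAlgebra D] (w : unitary D) (c : G → X → ℤ)
    (hc : ∀ g h x, c (g * h) x = c g (h • x) + c h x) (g : G) :
    star (monoMat w c g) = monoMat w c g⁻¹ := by
  ext y x
  have h1 : c 1 y = 0 := by simpa using hc 1 1 y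
  have h2 := hc g⁻¹ g y
  rw [inv_mul_cancel, h1] at h2
  rw [CStarMatrix.star_apply, monoMat_apply, monoMat_apply]
  by_cases hx : x = g • y
  · subst hx
    have : c g⁻¹ (g • y) = - c g y := by linarith
    rw [if_pos rfl, if_pos (by simp), this, zpow_neg]
    rfl
  · rw [if_neg hx, if_neg (by rintro rfl; simp at hx), star_zero]

/-- The monomial representation. -/
noncomputable def monoRep {D : Type} [CommCStarAlgebra D] (w : unitary D) (c : G → X → ℤ)
    (hc : ∀ g h x, c (g * h) x = c g (h • x) + c h x) : G →* unitary (CStarMatrix X X D) where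
  toFun g := ⟨monoMat w c g, by
    rw [Unitary.mem_iff, monoMat_star w c hc, ← monoMat_mul w c hc, ← monoMat_mul w c hc]
    simp [monoMat_one w c hc]⟩
  map_one' := Subtype.ext (monoMat_one w c hc)
  map_mul' g h := Subtype.ext (monoMat_mul w c hc g h)

end rep

section trace
open scoped ComplexOrder
variable {X : Type} [Fintype X] [DecidableEq X]

/-- Evaluation of a matrix of functions at a point. -/
noncomputable def evMat (z : Circle) :
    CStarMatrix X X C(Circle, ℂ) →ₐ[ℂ] Matrix X X ℂ :=
  (AlgHom.mapMatrix (ContinuousMap.evalAlgHom ℂ ℂ z)).comp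
    (CStarMatrix.ofMatrixStarAlgEquiv (n := X) (A := C(Circle, ℂ))).symm.toAlgEquiv.toAlgHom

lemma evMat_apply (z : Circle) (b : CStarMatrix X X C(Circle, ℂ)) (x y : X) :
    evMat z b x y = b x y z := rfl

lemma continuous_trace_evMat (b : CStarMatrix X X C(Circle, ℂ)) :
    Continuous fun z => (evMat z b).trace := by
  simp only [Matrix.trace, Matrix.diag, evMat_apply]
  fun_prop

lemma continuous_trace_evMat' (z : Circle) :
    Continuous fun b : CStarMatrix X X C(Circle, ℂ) => (evMat z b).trace := by
  simp only [Matrix.trace, Matrix.diag, evMat_apply]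
  refine continuous_finsetSum _ fun x _ => ?_
  have h : Continuous fun b : CStarMatrix X X C(Circle, ℂ) => b x x :=
    (continuous_apply x).comp (continuous_apply x)
  exact (continuous_eval_const z).comp h

lemma trace_mem (M : Matrix X X ℂ) (F : Set ℂ) (hF : spectrum ℂ M ⊆ F) :
    M.trace ∈ (fun v : Fin (Fintype.card X) → ℂ => ∑ i, v i) '' (Set.univ.pi fun _ => F) := by
  have hcard : Multiset.card M.charpoly.roots = Fintype.card X := by
    rw [← Matrix.charpoly_natDegree_eq_dim M]
    exact (IsAlgClosed.splits M.charpoly).natDegree_eq_card_roots.symm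
  rw [Matrix.trace_eq_sum_roots_charpoly]
  obtain ⟨l, hl⟩ : ∃ l : List ℂ, (l : Multiset ℂ) = M.charpoly.roots := Quot.exists_rep _
  have hlen : l.length = Fintype.card X := by rw [← hcard, ← hl]; rfl
  refine ⟨fun i => l.get (i.cast hlen.symm), ?_, ?_⟩
  · intro i _
    apply hF
    rw [Matrix.mem_spectrum_iff_isRoot_charpoly]
    apply Polynomial.isRoot_of_mem_roots
    rw [← hl]
    exact Multiset.mem_coe.2 (List.get_mem l _)
  · rw [← hl, Multiset.sum_coe]
    rw [← Fin.sum_univ_getElem l]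
    exact Fintype.sum_equiv (finCongr hlen.symm) _ _ fun i => rfl

lemma trace_const_of_finite (b : CStarMatrix X X C(Circle, ℂ)) (hb : (spectrum ℂ b).Finite)
    (z z' : Circle) : (evMat z b).trace = (evMat z' b).trace := by
  have hfin : ((fun v : Fin (Fintype.card X) → ℂ => ∑ i, v i) ''
      (Set.univ.pi fun _ => spectrum ℂ b)).Finite := (Set.Finite.pi' fun _ => hb).image _ |>.subset
        (Set.image_mono (fun v hv i => hv i trivial))
  have hsub : Set.range (fun z => (evMat z b).trace) ⊆
      (fun v : Fin (Fintype.card X) → ℂ => ∑ i, v i) '' (Set.univ.pi fun _ => spectrum ℂ b) := by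
    rintro _ ⟨z, rfl⟩
    exact trace_mem (evMat z b) (spectrum ℂ b) (AlgHom.spectrum_apply_subset (evMat z) b)
  exact hfin.countable.isTotallyDisconnected _ hsub
    (isPreconnected_range (continuous_trace_evMat b)) ⟨z, rfl⟩ ⟨z', rfl⟩

lemma trace_const {A : Type} [CStarAlgebra A] (hA : RealRankZero A)
    (φ : A →⋆ₐ[ℂ] CStarMatrix X X C(Circle, ℂ)) (a : A) (z z' : Circle) :
    (evMat z (φ a)).trace = (evMat z' (φ a)).trace := by
  have hφ : Continuous φ := (AddMonoidHomClass.lipschitz_of_bound φ 1 fun a => by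
      simpa using NonUnitalStarAlgHom.norm_apply_le φ a).continuous
  have key : ∀ a : A, IsSelfAdjoint a → (evMat z (φ a)).trace = (evMat z' (φ a)).trace := by
    intro a ha
    have hcl : IsClosed {a : A | (evMat z (φ a)).trace = (evMat z' (φ a)).trace} :=
      isClosed_eq ((continuous_trace_evMat' z).comp hφ) ((continuous_trace_evMat' z').comp hφ)
    refine closure_minimal ?_ hcl (hA ha)
    rintro b ⟨-, hb⟩
    exact trace_const_of_finite (φ b) (hb.subset (AlgHom.spectrum_apply_subset φ b)) z z'
  have h1 := key _ (realPart a).2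
  have h2 := key _ (imaginaryPart a).2
  rw [← realPart_add_I_smul_imaginaryPart a]
  simp only [map_add, map_smul, Matrix.trace_add, Matrix.trace_smul, h1, h2]

end trace

/-- The identity function as a unitary. -/
noncomputable def zUnit : unitary C(Circle, ℂ) :=
  ⟨⟨fun z => (z : ℂ), by fun_prop⟩, by
    rw [Unitary.mem_iff]
    constructor <;> ext z
    · change (starRingEnd ℂ) (z : ℂ) * (z : ℂ) = 1
      rw [← Circle.coe_inv_eq_conj, ← Circle.coe_mul]
      simp
    · change (z : ℂ) * (starRingEnd ℂ) (z : ℂ) = 1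
      rw [← Circle.coe_inv_eq_conj, ← Circle.coe_mul]
      simp⟩

lemma zUnit_zpow (k : ℤ) (z : Circle) :
    ((zUnit ^ k : unitary C(Circle, ℂ)) : C(Circle, ℂ)) z = ((z ^ k : Circle) : ℂ) := by
  have hn : ∀ n : ℕ, ((zUnit ^ n : unitary C(Circle, ℂ)) : C(Circle, ℂ)) z
      = ((z ^ n : Circle) : ℂ) := by
    intro n
    rw [SubmonoidClass.coe_pow, ContinuousMap.pow_apply, Circle.coe_pow]
    rfl
  cases k with
  | ofNat n => simpa using hn n
  | negSucc n =>
    rw [zpow_negSucc, zpow_negSucc, Circle.coe_inv_eq_conj, ← hn]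
    rfl

open scoped ComplexOrder in
lemma no_cocycle {G X : Type} [Group G] [MulAction G X] [Fintype X] [DecidableEq X]
    (A : Type) [CStarAlgebra A] (u : G →* unitary A)
    (huniv : ∀ (B : Type) [CStarAlgebra B] (v : G →* unitary B),
      ∃! φ : A →⋆ₐ[ℂ] B, ∀ g : G, φ (u g) = (v g : B))
    (hrr0 : RealRankZero A) (c : G → X → ℤ)
    (hc : ∀ g h x, c (g * h) x = c g (h • x) + c h x) (g : G) (x : X) (hx : g • x = x) :
    c g x = 0 := by
  by_contra hne
  obtain ⟨φ, hφ, -⟩ := huniv (CStarMatrix X X C(Circle, ℂ)) (monoRep zUnit c hc)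
  have htr : ∀ z : Circle, (evMat z (φ (u g))).trace =
      ∑ y : X, if y = g • y then ((z ^ c g y : Circle) : ℂ) else 0 := by
    intro z
    rw [hφ]
    refine Finset.sum_congr rfl fun y _ => ?_
    change (monoMat zUnit c g y y) z = _
    rw [monoMat_apply]
    split_ifs
    · exact zUnit_zpow _ _
    · rfl
  obtain ⟨z, hz⟩ : ∃ z : Circle, ((z ^ c g x : Circle) : ℂ) = -1 := by
    refine ⟨Circle.exp (Real.pi / c g x), ?_⟩
    rw [← Circle.exp_zsmul]
    have : (c g x : ℝ) ≠ 0 := by exact_mod_cast hne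
    rw [zsmul_eq_mul, mul_div_cancel₀ _ this]
    simp
  have h := trace_const hrr0 φ (u g) z 1
  rw [htr, htr] at h
  have h' := congrArg Complex.re h
  rw [Complex.re_sum, Complex.re_sum] at h'
  refine absurd h' (ne_of_lt (Finset.sum_lt_sum ?_ ⟨x, Finset.mem_univ _, ?_⟩))
  · intro y _
    split_ifs
    · simpa using (Complex.re_le_norm _).trans (Circle.norm_coe (z ^ c g y)).le
    · rfl
  · rw [if_pos hx.symm, if_pos hx.symm, hz]
    norm_num

lemma no_virtZ {G : Type} [Group G]
    (A : Type) [CStarAlgebra A] (u : G →* unitary A)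
    (huniv : ∀ (B : Type) [CStarAlgebra B] (v : G →* unitary B),
      ∃! φ : A →⋆ₐ[ℂ] B, ∀ g : G, φ (u g) = (v g : B))
    (hrr0 : RealRankZero A) : ¬ VirtZ G := by
  rintro ⟨H, hH, χ, k, hk⟩
  classical
  have : Fintype (G ⧸ H) := Fintype.ofFinite _
  let s : G ⧸ H → G := Quotient.out
  have hs : ∀ x : G ⧸ H, (s x : G ⧸ H) = x := fun x => Quotient.out_eq' x
  have hmem : ∀ (g : G) (x : G ⧸ H), (s (g • x))⁻¹ * (g * s x) ∈ H := by
    intro g x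
    rw [← QuotientGroup.eq, hs, ← smul_eq_mul, MulAction.Quotient.coe_smul_out]
  let c : G → G ⧸ H → ℤ := fun g x => (χ ⟨_, hmem g x⟩).toAdd
  have hc : ∀ g h x, c (g * h) x = c g (h • x) + c h x := by
    intro g h x
    simp only [c]
    rw [← toAdd_mul, ← map_mul]
    congr 2
    ext
    simp only [Subgroup.coe_mul, mul_smul]
    group
  have hx : (s ((1 : G) : G ⧸ H)) ∈ H := by
    have := hs ((1 : G) : G ⧸ H)
    rw [eq_comm, QuotientGroup.eq] at this
    simpa using this
  have hkx : (k : G) • ((1 : G) : G ⧸ H) = ((1 : G) : G ⧸ H) := by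
    rw [← MulAction.Quotient.coe_smul_out]
    rw [eq_comm, QuotientGroup.eq]
    simpa using H.mul_mem k.2 hx
  have := no_cocycle A u huniv hrr0 c hc k _ hkx
  apply hk
  have h2 : χ ⟨_, hmem k ((1 : G) : G ⧸ H)⟩ = 1 := this
  have h3 : (⟨_, hmem k ((1 : G) : G ⧸ H)⟩ : H) = ⟨_, hx⟩⁻¹ * (k * ⟨_, hx⟩) := by
    ext
    simp only [hkx]
    rfl
  rw [h3, map_mul, map_mul, map_inv] at h2
  rw [mul_comm (χ k)] at h2
  simpa using h2

/-- If `G` is a finitely generated elementary amenable group whose full group C*-algebra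
(i.e. a unital C*-algebra `A` together with a unitary representation `u` of `G` which is
universal for unitary representations of `G` in unital C*-algebras) has real rank zero,
then `G` is finite. -/
theorem finite_of_fg_elementaryAmenable_realRankZero
    (G : Type) [Group G] (hfg : Group.FG G) (hEA : ElementaryAmenable G)
    (A : Type) [CStarAlgebra A] (u : G →* unitary A)
    (huniv : ∀ (B : Type) [CStarAlgebra B] (v : G →* unitary B),
      ∃! φ : A →⋆ₐ[ℂ] B, ∀ g : G, φ (u g) = (v g : B))
    (hrr0 : RealRankZero A) : Finite G := by
  by_contra hinf
  rw [not_finite_iff_infinite] at hinf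
  exact no_virtZ A u huniv hrr0 (subQ_of_elementaryAmenable G hEA G G (MonoidHom.id G)
    (MonoidHom.id G) Function.injective_id Function.surjective_id hfg hinf)
end
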